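/- Let A be a polynomial vector field on ℂ^p and t ∈ ℂ with |t|·m(A) < 1. Then for every polynomial P ∈ ℂ[z₁,…,z_p] the series φ_t(P) := Σ_{n≥0} (t^n/n!)·coeff_0(D_A^n(P)) converges absolutely, and the resulting map φ_t : ℂ[z₁,…,z_p] → ℂ is a ℂ-algebra homomorphism: φ_t(1) = 1 and φ_t(P·Q) = φ_t(P)·φ_t(Q) for all polynomials P, Q. -/

import Mathlib

open MvPolynomial

noncomputable def vfDeriv {p : ℕ} (A : Fin p → MvPolynomial (Fin p) ℂ)
    (P : MvPolynomial (Fin p) ℂ) : MvPolynomial (Fin p) ℂ :=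
  ∑ i, A i * pderiv i P

noncomputable def vfNorm {p : ℕ} (A : Fin p → MvPolynomial (Fin p) ℂ) : ℝ :=
  ⨆ i, ∑ m ∈ (A i).support, ‖(A i).coeff m‖

/-- The general Leibniz rule for iterates of a derivation of a commutative algebra. -/
theorem Derivation.iterate_apply_mul {R S : Type*} [CommSemiring R] [CommSemiring S] [Algebra R S]
    (D : Derivation R S S) (n : ℕ) (a b : S) :
    D^[n] (a * b) =
      ∑ ij ∈ Finset.HasAntidiagonal.antidiagonal n,
        n.choose ij.1 • (D^[ij.1] a * D^[ij.2] b) := by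
  induction n with
  | zero => simp
  | succ n ih =>
    rw [Finset.sum_antidiagonal_choose_succ_nsmul (M := S) (fun i j => D^[i] a * D^[j] b) n]
    simp only [Function.iterate_succ_apply', ih, map_sum, map_nsmul, Derivation.leibniz, smul_add,
      Finset.sum_add_distrib, smul_eq_mul]
    congr 1
    refine Finset.sum_congr rfl fun ⟨i, j⟩ hij => ?_
    rw [n.choose_symm_of_eq_add (Finset.HasAntidiagonal.mem_antidiagonal.1 hij).symm, mul_comm (D^[j] b)]

/-- The derivation `vfDeriv A`, as a bundled derivation. -/
noncomputable def vfDerivation {p : ℕ} (A : Fin p → MvPolynomial (Fin p) ℂ) :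
    Derivation ℂ (MvPolynomial (Fin p) ℂ) (MvPolynomial (Fin p) ℂ) :=
  ∑ i, A i • pderiv i

theorem coe_vfDerivation {p : ℕ} (A : Fin p → MvPolynomial (Fin p) ℂ) :
    ⇑(vfDerivation A) = vfDeriv A := by
  ext1 P
  have h : ⇑(vfDerivation A) = ∑ i, ⇑(A i • pderiv (R := ℂ) i) :=
    map_sum Derivation.coeFnAddMonoidHom _ _
  rw [h, Finset.sum_apply]
  rfl

/-- The linear functional sending `P` to the constant coefficient of the `n`-th iterated
derivative of `P` along `A`. -/
noncomputable def vfIterCoeff {p : ℕ} (A : Fin p → MvPolynomial (Fin p) ℂ) (n : ℕ) :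
    MvPolynomial (Fin p) ℂ →ₗ[ℂ] ℂ :=
  lcoeff ℂ 0 ∘ₗ (vfDerivation A).toLinearMap ^ n

theorem vfIterCoeff_apply {p : ℕ} (A : Fin p → MvPolynomial (Fin p) ℂ) (n : ℕ)
    (P : MvPolynomial (Fin p) ℂ) : vfIterCoeff A n P = coeff 0 ((vfDeriv A)^[n] P) := by
  simp only [vfIterCoeff, LinearMap.comp_apply, Module.End.pow_apply, Derivation.coeFn_coe,
    coe_vfDerivation]
  rfl

theorem vfIterCoeff_succ {p : ℕ} (A : Fin p → MvPolynomial (Fin p) ℂ) (n : ℕ)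
    (P : MvPolynomial (Fin p) ℂ) : vfIterCoeff A (n + 1) P = vfIterCoeff A n (vfDeriv A P) := by
  simp only [vfIterCoeff_apply, Function.iterate_succ_apply]

theorem vfDeriv_monomial {p : ℕ} (A : Fin p → MvPolynomial (Fin p) ℂ) (k : Fin p →₀ ℕ) :
    vfDeriv A (monomial k 1) = ∑ i, ∑ m ∈ (A i).support,
      ((k i : ℂ) * (A i).coeff m) • monomial (m + (k - Finsupp.single i 1)) (1 : ℂ) := by
  refine Finset.sum_congr rfl fun i _ => ?_
  conv_lhs => rw [(A i).as_sum, pderiv_monomial, Finset.sum_mul]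
  refine Finset.sum_congr rfl fun m _ => ?_
  rw [monomial_mul, smul_monomial]
  congr 1
  simp [mul_comm]

theorem vfIterCoeff_succ_monomial {p : ℕ} (A : Fin p → MvPolynomial (Fin p) ℂ) (n : ℕ)
    (k : Fin p →₀ ℕ) :
    vfIterCoeff A (n + 1) (monomial k 1) = ∑ i, ∑ m ∈ (A i).support,
      ((k i : ℂ) * (A i).coeff m) *
        vfIterCoeff A n (monomial (m + (k - Finsupp.single i 1)) 1) := by
  simp only [vfIterCoeff_succ, vfDeriv_monomial, map_sum, map_smul, smul_eq_mul]

theorem sum_norm_coeff_le_vfNorm {p : ℕ} (A : Fin p → MvPolynomial (Fin p) ℂ) (i : Fin p) :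
    ∑ m ∈ (A i).support, ‖(A i).coeff m‖ ≤ vfNorm A :=
  le_ciSup (f := fun i => ∑ m ∈ (A i).support, ‖(A i).coeff m‖) (Set.finite_range _).bddAbove i

theorem vfNorm_nonneg {p : ℕ} (A : Fin p → MvPolynomial (Fin p) ℂ) : 0 ≤ vfNorm A :=
  Real.iSup_nonneg fun _ => Finset.sum_nonneg fun _ _ => norm_nonneg _

/-- Each derivative lowers the degree by at most one, so monomials of degree larger than `n`
do not contribute to the constant coefficient after `n` derivatives. -/
theorem vfIterCoeff_monomial_eq_zero {p : ℕ} (A : Fin p → MvPolynomial (Fin p) ℂ) (n : ℕ)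
    (k : Fin p →₀ ℕ) (hk : n < k.degree) : vfIterCoeff A n (monomial k 1) = 0 := by
  induction n generalizing k with
  | zero =>
    have hk0 : k ≠ 0 := by
      rintro rfl
      simp at hk
    simp [vfIterCoeff_apply, coeff_monomial, hk0]
  | succ n ih =>
    rw [vfIterCoeff_succ_monomial]
    refine Finset.sum_eq_zero fun i _ => Finset.sum_eq_zero fun m _ => ?_
    rcases Nat.eq_zero_or_pos (k i) with hi | hi
    · simp [hi]
    · rw [ih, mul_zero]
      have h1 : k - Finsupp.single i 1 + Finsupp.single i 1 = k :=
        tsub_add_cancel_of_le (Finsupp.single_le_iff.2 hi)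
      have h2 := congrArg Finsupp.degree h1
      rw [map_add, Finsupp.degree_single] at h2
      rw [map_add]
      lia

theorem norm_vfIterCoeff_monomial_le {p : ℕ} (A : Fin p → MvPolynomial (Fin p) ℂ) (n : ℕ)
    (k : Fin p →₀ ℕ) : ‖vfIterCoeff A n (monomial k 1)‖ ≤ n.factorial * vfNorm A ^ n := by
  have hM := vfNorm_nonneg A
  induction n generalizing k with
  | zero =>
    simp only [vfIterCoeff_apply, Function.iterate_zero, id, coeff_monomial]
    split_ifs <;> simp
  | succ n ih =>
    rcases lt_or_ge (n + 1) k.degree with hk | hk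
    · rw [vfIterCoeff_monomial_eq_zero A _ k hk, norm_zero]
      positivity
    rw [vfIterCoeff_succ_monomial]
    have hk' : ∑ i, (k i : ℝ) ≤ n + 1 := by
      rw [Finsupp.degree_eq_sum] at hk
      exact_mod_cast hk
    calc _ ≤ ∑ i, ∑ m ∈ (A i).support,
            ((k i : ℝ) * ‖(A i).coeff m‖) * (n.factorial * vfNorm A ^ n) := by
          refine norm_sum_le_of_le _ fun i _ => norm_sum_le_of_le _ fun m _ => ?_
          rw [norm_mul, norm_mul, Complex.norm_natCast]
          gcongr
          exact ih _
      _ = ∑ i, (k i : ℝ) * (∑ m ∈ (A i).support, ‖(A i).coeff m‖) *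
            (n.factorial * vfNorm A ^ n) := by
          simp only [Finset.mul_sum, Finset.sum_mul]
      _ ≤ ∑ i, (k i : ℝ) * vfNorm A * (n.factorial * vfNorm A ^ n) := by
          gcongr with i
          exact sum_norm_coeff_le_vfNorm A i
      _ = (∑ i, (k i : ℝ)) * (vfNorm A * (n.factorial * vfNorm A ^ n)) := by
          simp only [Finset.sum_mul, mul_assoc]
      _ ≤ (n + 1) * (vfNorm A * (n.factorial * vfNorm A ^ n)) := by gcongr
      _ = (n + 1).factorial * vfNorm A ^ (n + 1) := by
          rw [Nat.factorial_succ]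
          push_cast
          ring

theorem norm_vfIterCoeff_le {p : ℕ} (A : Fin p → MvPolynomial (Fin p) ℂ) (n : ℕ)
    (P : MvPolynomial (Fin p) ℂ) :
    ‖vfIterCoeff A n P‖ ≤ (∑ k ∈ P.support, ‖P.coeff k‖) * (n.factorial * vfNorm A ^ n) := by
  have hP : vfIterCoeff A n P =
      ∑ k ∈ P.support, P.coeff k * vfIterCoeff A n (monomial k 1) := by
    conv_lhs => rw [P.as_sum, map_sum]
    refine Finset.sum_congr rfl fun k _ => ?_
    rw [← smul_eq_mul, ← map_smul, smul_monomial, smul_eq_mul, mul_one]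
  rw [hP, Finset.sum_mul]
  refine norm_sum_le_of_le _ fun k _ => ?_
  rw [norm_mul]
  gcongr
  exact norm_vfIterCoeff_monomial_le A n k

theorem summable_norm_vfFlow {p : ℕ} (A : Fin p → MvPolynomial (Fin p) ℂ) (t : ℂ)
    (ht : ‖t‖ * vfNorm A < 1) (P : MvPolynomial (Fin p) ℂ) :
    Summable fun n : ℕ =>
      ‖(t ^ n / (Nat.factorial n : ℂ)) * coeff 0 ((vfDeriv A)^[n] P)‖ := by
  refine Summable.of_nonneg_of_le (fun _ => norm_nonneg _) (fun n => ?_)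
    ((summable_geometric_of_lt_one (mul_nonneg (norm_nonneg t) (vfNorm_nonneg A)) ht).mul_left
      (∑ k ∈ P.support, ‖P.coeff k‖))
  rw [← vfIterCoeff_apply, norm_mul, norm_div, norm_pow, Complex.norm_natCast]
  calc _ ≤ ‖t‖ ^ n / n.factorial *
          ((∑ k ∈ P.support, ‖P.coeff k‖) * (n.factorial * vfNorm A ^ n)) := by
        gcongr
        exact norm_vfIterCoeff_le A n P
    _ = _ := by
        field_simp
        ring

theorem vfFlow_term_mul {p : ℕ} (A : Fin p → MvPolynomial (Fin p) ℂ) (t : ℂ) (n : ℕ)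
    (P Q : MvPolynomial (Fin p) ℂ) :
    (t ^ n / (Nat.factorial n : ℂ)) * coeff 0 ((vfDeriv A)^[n] (P * Q)) =
      ∑ ij ∈ Finset.HasAntidiagonal.antidiagonal n,
        ((t ^ ij.1 / (Nat.factorial ij.1 : ℂ)) * coeff 0 ((vfDeriv A)^[ij.1] P)) *
          ((t ^ ij.2 / (Nat.factorial ij.2 : ℂ)) * coeff 0 ((vfDeriv A)^[ij.2] Q)) := by
  rw [← coe_vfDerivation, Derivation.iterate_apply_mul, coeff_sum, Finset.mul_sum]
  refine Finset.sum_congr rfl fun ⟨i, j⟩ hij => ?_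
  obtain rfl : i + j = n := Finset.HasAntidiagonal.mem_antidiagonal.1 hij
  have hc : ((i + j).choose i : ℂ) * i.factorial * j.factorial = (i + j).factorial := by
    rw [Nat.choose_symm_add]
    exact_mod_cast Nat.add_choose_mul_factorial_mul_factorial i j
  have hi : (i.factorial : ℂ) ≠ 0 := by exact_mod_cast i.factorial_ne_zero
  have hj : (j.factorial : ℂ) ≠ 0 := by exact_mod_cast j.factorial_ne_zero
  have hij0 : ((i + j).factorial : ℂ) ≠ 0 := by exact_mod_cast (i + j).factorial_ne_zero
  simp only [nsmul_eq_mul, ← constantCoeff_eq, map_mul, map_natCast]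
  field_simp
  rw [← hc]
  ring

/-- if `|t|·m(A) < 1` then for every polynomial `P` the series
`φ_t(P) := Σ_{n≥0} (t^n/n!)·coeff_0(D_A^n(P))` converges absolutely and
`φ_t` is a `ℂ`-algebra homomorphism: `φ_t(1) = 1` and `φ_t(P·Q) = φ_t(P)·φ_t(Q)`. -/
theorem stmt_10 (p : ℕ) (hp : 0 < p) (A : Fin p → MvPolynomial (Fin p) ℂ)
    (t : ℂ) (ht : ‖t‖ * vfNorm A < 1) :
    (∀ P : MvPolynomial (Fin p) ℂ,
      Summable fun n : ℕ =>
        ‖(t ^ n / (Nat.factorial n : ℂ)) * coeff 0 ((vfDeriv A)^[n] P)‖) ∧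
    (∑' n : ℕ, (t ^ n / (Nat.factorial n : ℂ)) *
        coeff 0 ((vfDeriv A)^[n] (1 : MvPolynomial (Fin p) ℂ))) = 1 ∧
    (∀ P Q : MvPolynomial (Fin p) ℂ,
      (∑' n : ℕ, (t ^ n / (Nat.factorial n : ℂ)) * coeff 0 ((vfDeriv A)^[n] (P * Q))) =
        (∑' n : ℕ, (t ^ n / (Nat.factorial n : ℂ)) * coeff 0 ((vfDeriv A)^[n] P)) *
          (∑' n : ℕ, (t ^ n / (Nat.factorial n : ℂ)) * coeff 0 ((vfDeriv A)^[n] Q))) := by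
  have hs := summable_norm_vfFlow A t ht
  refine ⟨hs, ?_, fun P Q => ?_⟩
  · rw [tsum_eq_single 0]
    · simp
    · intro n hn
      obtain ⟨m, rfl⟩ := Nat.exists_eq_succ_of_ne_zero hn
      rw [← vfIterCoeff_apply, vfIterCoeff_succ, ← coe_vfDerivation,
        Derivation.map_one_eq_zero, map_zero, mul_zero]
  · rw [tsum_mul_tsum_eq_tsum_sum_antidiagonal_of_summable_norm (hs P) (hs Q)]
    exact tsum_congr fun n => vfFlow_term_mul A t n P Q
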